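/- Let α > 1 and let f belong to the Müntz class M_α. Then for every x > 0 and every σ with 0 < σ < 1, (1/(2πi)) ∫_{σ−i∞}^{σ+i∞} ζ(s)² f*(s) x^{−s} ds = Σ_{n=1}^∞ d(n) f(nx) − ∫₀^∞ f(xy)(log y + 2γ) dy, where the right-hand side (the Voronoi operator (Vf)(x)) is well defined. -/

import Mathlib

open MeasureTheory Filter Asymptotics Set Complex

noncomputable section

/-- The Mellin transform of `f`. -/
def mellinT (f : ℝ → ℂ) (s : ℂ) : ℂ := ∫ x in Ioi (0:ℝ), (x : ℂ) ^ (s - 1) * f x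

/-- The Müntz class `M_α`. -/
def MuntzClass (α : ℝ) (f : ℝ → ℂ) : Prop :=
  ContDiffOn ℝ 2 f (Ici 0) ∧
  ∀ j : ℕ, j ≤ 2 →
    (iteratedDerivWithin j f (Ici 0)) =O[atTop] fun x : ℝ => x ^ (-(α + (j : ℝ)))

/-- The Möbius transformation `(Θf)(x) = ∑ f(nx)`. -/
def thetaOp (f : ℝ → ℂ) (x : ℝ) : ℂ := ∑' n : ℕ, f ((n + 1 : ℝ) * x)

/-- The Müntz operator. -/
def muntzOp (f : ℝ → ℂ) (x : ℝ) : ℂ :=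
  thetaOp f x - (x : ℂ)⁻¹ * ∫ y in Ioi (0:ℝ), f y

/-- `(1/(2πi)) ∫_{σ-i∞}^{σ+i∞} g(s) ds`. -/
def lineIntegral (g : ℂ → ℂ) (σ : ℝ) : ℂ :=
  (2 * Real.pi)⁻¹ • ∫ t : ℝ, g (σ + t * Complex.I)

/-- The Fourier cosine transform. -/
def fourierCos (f : ℝ → ℂ) (x : ℝ) : ℂ :=
  (Real.sqrt (2 / Real.pi) : ℂ) * ∫ t in Ioi (0:ℝ), f t * (Real.cos (x * t) : ℂ)

/-- The reduced Möbius operator. -/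
def thetaHat (f : ℝ → ℂ) (x : ℝ) : ℂ :=
  ∑' n : ℕ, ((|ArithmeticFunction.moebius (n + 1)| : ℤ) : ℂ) * f ((n + 1 : ℝ) * x)

/-- The Voronoi operator. -/
def voronoiOp (f : ℝ → ℂ) (x : ℝ) : ℂ :=
  (∑' n : ℕ, ((n + 1 : ℕ).divisors.card : ℂ) * f ((n + 1 : ℝ) * x)) -
    ∫ y in Ioi (0:ℝ), f (x * y) *
      ((Real.log y + 2 * Real.eulerMascheroniConstant : ℝ) : ℂ)

open FourierTransform SchwartzMap in
lemma memLp_fourier_aux (f : ℝ → ℂ) (h1 : Integrable f) (h2 : MemLp f 2) :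
    MemLp (𝓕 f : ℝ → ℂ) 2 := by
  let F : Lp ℂ 2 (volume : Measure ℝ) := h2.toLp f
  let g : Lp ℂ 2 (volume : Measure ℝ) := 𝓕 F
  have key : ∀ φ : 𝓢(ℝ, ℂ), ∫ x, φ x • g x = ∫ x, φ x • (𝓕 f : ℝ → ℂ) x := by
    intro φ
    have e1 := congrArg (fun T : 𝓢'(ℝ, ℂ) => T φ) (Lp.fourier_toTemperedDistribution_eq F)
    simp only [TemperedDistribution.fourier_apply, Lp.toTemperedDistribution_apply] at e1
    rw [← e1]
    have e2 : ∫ x, (𝓕 φ) x • F x = ∫ x, (𝓕 φ) x • f x := by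
      apply integral_congr_ae
      filter_upwards [h2.coeFn_toLp] with x hx
      rw [show F x = f x from hx]
    rw [e2]
    have := VectorFourier.integral_fourierIntegral_smul_eq_flip (μ := volume) (ν := volume)
      (L := innerₗ ℝ) (e := Real.fourierChar) (f := (φ : ℝ → ℂ)) (g := f) Real.continuous_fourierChar
      continuous_inner φ.integrable h1
    rw [flip_innerₗ] at this
    exact this
  have hloc : LocallyIntegrable (𝓕 f : ℝ → ℂ) volume := by
    apply Continuous.locallyIntegrable
    exact VectorFourier.fourierIntegral_continuous Real.continuous_fourierChar
      (by exact continuous_inner) h1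
  have hae : ∀ᵐ x, g x = (𝓕 f : ℝ → ℂ) x := by
    apply ae_eq_of_integral_contDiff_smul_eq ((Lp.memLp g).locallyIntegrable (by norm_num)) hloc
    intro φ hφ hc
    have hc' : HasCompactSupport (fun x => (φ x : ℂ)) := hc.comp_left (g := Complex.ofReal) (by simp)
    have hd' : ContDiff ℝ (⊤ : ℕ∞) (fun x => (φ x : ℂ)) := Complex.ofRealCLM.contDiff.comp hφ
    have := key (hc'.toSchwartzMap hd')
    simpa using this
  exact (memLp_congr_ae hae).1 (Lp.memLp g)
/-- Fractional part cut off to `(1, ∞)`. -/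
def kfr : ℝ → ℂ := indicator (Ioi 1) (fun t => ((Int.fract t : ℝ) : ℂ))

lemma kfr_norm_le (t : ℝ) : ‖kfr t‖ ≤ 1 := by
  unfold kfr
  rw [norm_indicator_eq_indicator_norm]
  refine indicator_le' (fun x _ => ?_) (fun x _ => zero_le_one) t
  rw [Complex.norm_real, Real.norm_of_nonneg (Int.fract_nonneg x)]
  exact (Int.fract_lt_one x).le

lemma kfr_meas : Measurable kfr := by
  unfold kfr
  exact (Complex.measurable_ofReal.comp measurable_fract).indicator measurableSet_Ioi

lemma kfr_loc : LocallyIntegrableOn kfr (Ioi 0) := by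
  apply LocallyIntegrable.locallyIntegrableOn
  apply (locallyIntegrable_const (1:ℝ)).mono kfr_meas.aestronglyMeasurable
  filter_upwards with x
  simpa using kfr_norm_le x

lemma kfr_top : kfr =O[atTop] (fun x : ℝ => x ^ (-(0:ℝ))) := by
  apply IsBigO.of_bound 1
  filter_upwards with x
  simpa using kfr_norm_le x

lemma kfr_bot (b : ℝ) : kfr =O[nhdsWithin 0 (Ioi 0)] (fun x : ℝ => x ^ (-b)) := by
  have : kfr =ᶠ[nhdsWithin 0 (Ioi 0)] fun _ => 0 := by
    filter_upwards [Ioo_mem_nhdsGT (zero_lt_one' ℝ)] with x hx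
    unfold kfr
    exact indicator_of_notMem (by simpa using hx.2.le) _
  exact this.trans_isBigO (isBigO_zero _ _)

lemma kfr_conv {s : ℂ} (hs : s.re < 0) : MellinConvergent kfr s :=
  mellinConvergent_of_isBigO_rpow kfr_loc kfr_top hs (kfr_bot (s.re - 1)) (by linarith)

lemma kfr_diff {s : ℂ} (hs : s.re < 0) : DifferentiableAt ℂ (mellin kfr) s :=
  mellin_differentiableAt_of_isBigO_rpow kfr_loc kfr_top hs (kfr_bot (s.re - 1)) (by linarith)

lemma kfr_mellin (s : ℂ) : mellin kfr s =
    ∫ t in Ioi (1:ℝ), (t:ℂ) ^ (s - 1) * ((Int.fract t : ℝ) : ℂ) := by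
  unfold mellin kfr
  have : ∀ t : ℝ, (t:ℂ) ^ (s - 1) • (Ioi (1:ℝ)).indicator (fun t => ((Int.fract t : ℝ) : ℂ)) t
      = (Ioi (1:ℝ)).indicator (fun t : ℝ => (t:ℂ) ^ (s - 1) * ((Int.fract t : ℝ) : ℂ)) t := by
    intro t
    by_cases h : t ∈ Ioi (1:ℝ) <;> simp [h]
  simp_rw [this]
  rw [setIntegral_indicator measurableSet_Ioi]
  congr 2
  ext x; simp

lemma kfr_intOn {s : ℂ} (hs : s.re < 0) : IntegrableOn
    (fun t : ℝ => (t:ℂ) ^ (s - 1) * ((Int.fract t : ℝ) : ℂ)) (Ioi 1) := by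
  have := (kfr_conv hs).mono_set (Ioi_subset_Ioi (zero_le_one' ℝ))
  refine this.congr_fun (fun t ht => ?_) measurableSet_Ioi
  simp [kfr, mem_Ioi.1 ht]

lemma kfr_bound {s : ℂ} (hs : s.re < 0) : ‖mellin kfr s‖ ≤ 1 / (-s.re) := by
  rw [kfr_mellin]
  have h1 : ∫ t in Ioi (1:ℝ), t ^ (s.re - 1) = 1 / (-s.re) := by
    rw [integral_Ioi_rpow_of_lt (by linarith) one_pos]
    simp; field_simp
  rw [← h1]
  refine norm_integral_le_of_norm_le (integrableOn_Ioi_rpow_of_lt (by linarith) one_pos) ?_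
  filter_upwards [ae_restrict_mem measurableSet_Ioi] with t ht
  have ht0 : (0:ℝ) < t := zero_lt_one.trans ht
  rw [norm_mul, Complex.norm_cpow_eq_rpow_re_of_pos ht0, Complex.norm_real,
    Real.norm_of_nonneg (Int.fract_nonneg t)]
  simp only [sub_re, one_re]
  exact mul_le_of_le_one_right (by positivity) (Int.fract_lt_one t).le

lemma zeta_formula_gt {s : ℂ} (hs : 1 < s.re) :
    riemannZeta s = s / (s - 1) - s * mellin kfr (-s) := by
  have hsum : (fun n : ℕ ↦ ∑ k ∈ Finset.Icc 1 n, (1 : ℕ → ℂ) k) =O[atTop] fun n ↦ (n : ℝ) ^ (1:ℝ) := by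
    apply IsBigO.of_bound 1
    filter_upwards with n
    simp
  have h := LSeries_eq_mul_integral (1 : ℕ → ℂ) zero_le_one hs (LSeriesSummable_one_iff.2 hs) hsum
  rw [LSeries_one_eq_riemannZeta hs] at h
  have hs1 : s - 1 ≠ 0 := by
    intro h; have := congrArg re h; simp at this; linarith
  have e1 : ∫ t in Ioi (1:ℝ), (∑ k ∈ Finset.Icc 1 ⌊t⌋₊, (1 : ℕ → ℂ) k) * (t:ℂ) ^ (-(s + 1))
      = ∫ t in Ioi (1:ℝ), ((t:ℂ) ^ (-s) - (t:ℂ) ^ (-s - 1) * ((Int.fract t : ℝ) : ℂ)) := by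
    apply setIntegral_congr_fun measurableSet_Ioi
    intro t ht
    have ht0 : (0:ℝ) < t := zero_lt_one.trans ht
    have htc : (t:ℂ) ≠ 0 := by exact_mod_cast ht0.ne'
    have hfl : ((⌊t⌋₊ : ℕ) : ℂ) = (t:ℂ) - ((Int.fract t : ℝ) : ℂ) := by
      rw [← Complex.ofReal_sub, Int.self_sub_fract, ← natCast_floor_eq_intCast_floor ht0.le]
      simp
    simp only [Pi.one_apply, Finset.sum_const, Nat.card_Icc, add_tsub_cancel_right, nsmul_eq_mul,
      mul_one, hfl]
    rw [show -s = -s - 1 + 1 by ring, Complex.cpow_add _ _ htc, Complex.cpow_one]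
    rw [show -(s+1) = -s-1 by ring, show (-s - 1 + 1 - 1 : ℂ) = -s - 1 by ring]
    ring
  rw [h, e1, integral_sub, integral_Ioi_cpow_of_lt (by simpa using hs) one_pos, kfr_mellin]
  · simp only [ofReal_one, one_cpow]
    have : -s + 1 ≠ 0 := by intro h; apply hs1; linear_combination -h
    field_simp
    rw [show -s + 1 = -(s-1) by ring]
    field_simp
    ring
  · exact integrableOn_Ioi_cpow_of_lt (by simpa using hs) one_pos
  · exact kfr_intOn (by simp; linarith)

lemma zeta_formula {s : ℂ} (hs : 0 < s.re) (h1 : s ≠ 1) :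
    riemannZeta s = s / (s - 1) - s * mellin kfr (-s) := by
  have hU : IsOpen {z : ℂ | 0 < z.re} := isOpen_lt continuous_const continuous_re
  have hA : AnalyticOnNhd ℂ riemannZeta₁ {z : ℂ | 0 < z.re} :=
    differentiable_riemannZeta₁.differentiableOn.analyticOnNhd hU
  have hB : AnalyticOnNhd ℂ (fun z => z - z * (z - 1) * mellin kfr (-z)) {z : ℂ | 0 < z.re} := by
    apply DifferentiableOn.analyticOnNhd _ hU
    intro z hz
    have hd : DifferentiableAt ℂ (fun z => mellin kfr (-z)) z :=
      (kfr_diff (s := -z) (by simpa using hz)).comp z differentiableAt_id.neg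
    exact (by fun_prop : DifferentiableAt ℂ (fun z => z - z * (z - 1) * mellin kfr (-z)) z).differentiableWithinAt
  have hc : IsPreconnected {z : ℂ | 0 < z.re} := (convex_halfSpace_re_gt 0).isPreconnected
  have := hA.eqOn_of_preconnected_of_eventuallyEq hB hc (z₀ := 2) (by simp) ?_ hs
  · rw [riemannZeta_eq_inv_sub_mul h1, this]
    have : s - 1 ≠ 0 := sub_ne_zero.2 h1
    field_simp
  · have hV : {z : ℂ | 1 < z.re} ∈ nhds (2:ℂ) :=
      (isOpen_lt continuous_const continuous_re).mem_nhds (by simp)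
    filter_upwards [hV] with z hz
    have hz1 : z ≠ 1 := by rintro rfl; simp at hz
    have h := zeta_formula_gt hz
    rw [riemannZeta_eq_inv_sub_mul hz1] at h
    have : z - 1 ≠ 0 := sub_ne_zero.2 hz1
    field_simp at h
    rw [h]; ring

lemma zeta_div_bound {s : ℂ} (hs : 0 < s.re) (h1 : s ≠ 1) :
    ‖riemannZeta s / s‖ ≤ 1 / ‖s - 1‖ + 1 / s.re := by
  have h0 : s ≠ 0 := by rintro rfl; simp at hs
  have h2 : s - 1 ≠ 0 := sub_ne_zero.2 h1
  have : riemannZeta s / s = 1 / (s - 1) - mellin kfr (-s) := by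
    rw [zeta_formula hs h1]; field_simp
  rw [this]
  refine (norm_sub_le _ _).trans ?_
  gcongr
  · simp
  · simpa using kfr_bound (s := -s) (by simpa using hs)

lemma zeta_fract {s : ℂ} (hs : 0 < s.re) (hs1 : s.re < 1) :
    riemannZeta s / s = - mellin (fun t => ((Int.fract t : ℝ) : ℂ)) (-s) := by
  have h0 : s ≠ 0 := by rintro rfl; simp at hs
  have h1 : s ≠ 1 := by rintro rfl; simp at hs1
  have h2 : s - 1 ≠ 0 := sub_ne_zero.2 h1
  have h3 : 1 - s ≠ 0 := sub_ne_zero.2 h1.symm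
  have e : riemannZeta s / s = 1 / (s - 1) - mellin kfr (-s) := by
    rw [zeta_formula hs h1]; field_simp
  have ee : EqOn (fun t : ℝ => (t:ℂ) ^ (-s - 1) * ((Int.fract t : ℝ) : ℂ)) 
      (fun t : ℝ => (t:ℂ) ^ (-s)) (Ioo 0 1) := by
    intro t ht
    have htc : (t:ℂ) ≠ 0 := by exact_mod_cast ht.1.ne'
    simp only
    rw [Int.fract_eq_self.2 ⟨ht.1.le, ht.2⟩]
    conv_rhs => rw [show -s = -s - 1 + 1 by ring, Complex.cpow_add _ _ htc, Complex.cpow_one]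
  have hi : IntegrableOn (fun t : ℝ => (t:ℂ) ^ (-s)) (Ioo 0 1) := by
    rw [← integrableOn_Ioc_iff_integrableOn_Ioo, ← intervalIntegrable_iff_integrableOn_Ioc_of_le zero_le_one]
    exact intervalIntegral.intervalIntegrable_cpow' (by simpa using hs1)
  have hsplit : mellin (fun t => ((Int.fract t : ℝ) : ℂ)) (-s) = 1 / (1 - s) + mellin kfr (-s) := by
    rw [kfr_mellin, mellin]
    simp only [smul_eq_mul]
    rw [← Ioc_union_Ioi_eq_Ioi (zero_le_one' ℝ), setIntegral_union (by
      rw [Set.disjoint_left]; rintro x ⟨_, h⟩ h'; exact absurd h' (not_lt.2 h)) measurableSet_Ioi]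
    · congr 1
      rw [integral_Ioc_eq_integral_Ioo, setIntegral_congr_fun measurableSet_Ioo ee,
        ← integral_Ioc_eq_integral_Ioo, ← intervalIntegral.integral_of_le zero_le_one,
        integral_cpow (Or.inl (by simpa using hs1))]
      have : -s + 1 ≠ 0 := by intro h; apply h3; linear_combination h
      simp [Complex.zero_cpow this]
      rw [show -s + 1 = 1 - s by ring]
    · rw [integrableOn_Ioc_iff_integrableOn_Ioo]
      exact hi.congr_fun ee.symm measurableSet_Ioo
    · exact kfr_intOn (by simpa using hs)
  rw [e, hsplit]
  field_simp
  rw [show 1 - s = -(s-1) by ring]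
  field_simp
  ring

lemma integrable_rexp_neg_abs_aux {δ : ℝ} (hδ : 0 < δ) :
    Integrable (fun u : ℝ => Real.exp (-δ * |u|)) := by
  rw [← integrableOn_univ, ← Iic_union_Ioi (a := (0:ℝ)), integrableOn_union]
  constructor
  · refine (integrableOn_exp_mul_Iic hδ 0).congr_fun (fun x hx => ?_) measurableSet_Iic
    simp only
    rw [abs_of_nonpos hx]; ring_nf
  · refine (exp_neg_integrableOn_Ioi 0 hδ).congr_fun (fun x hx => ?_) measurableSet_Ioi
    simp only
    rw [abs_of_pos hx]

open FourierTransform in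
lemma zeta_sq_int {σ : ℝ} (h0 : 0 < σ) (h1 : σ < 1) :
    Integrable (fun t : ℝ => ‖riemannZeta (σ + t * I) / (σ + t * I)‖ ^ 2) := by
  let φ : ℝ → ℂ := fun u => Real.exp (σ * u) • ((Int.fract (Real.exp (-u)) : ℝ) : ℂ)
  set δ := min σ (1 - σ)
  have hδ : 0 < δ := lt_min h0 (by linarith)
  have hδ1 : δ ≤ σ := min_le_left _ _
  have hδ2 : δ ≤ 1 - σ := min_le_right _ _
  have hb : ∀ u, ‖φ u‖ ≤ Real.exp (-δ * |u|) := by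
    intro u
    simp only [φ, norm_smul, Complex.norm_real, Real.norm_eq_abs, Real.abs_exp,
      abs_of_nonneg (Int.fract_nonneg (Real.exp (-u)))]
    rcases le_or_gt u 0 with hu | hu
    · rw [abs_of_nonpos hu]
      refine (mul_le_of_le_one_right (by positivity) (Int.fract_lt_one _).le).trans ?_
      apply Real.exp_le_exp.2; nlinarith
    · rw [abs_of_pos hu, Int.fract_eq_self.2 ⟨by positivity, by simpa using hu⟩, ← Real.exp_add]
      apply Real.exp_le_exp.2; nlinarith
  have hE : Integrable (fun u : ℝ => Real.exp (-δ * |u|)) := by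
    have := integrable_rexp_neg_abs_aux hδ
    simpa using this
  have hm : Measurable φ := by
    refine Measurable.smul (f := fun u : ℝ => Real.exp (σ * u)) (by fun_prop) ?_
    exact Complex.measurable_ofReal.comp (measurable_fract.comp (by fun_prop))
  have hφ1 : Integrable φ := hE.mono' hm.aestronglyMeasurable (Eventually.of_forall hb)
  have hφ2 : MemLp φ 2 := by
    rw [memLp_two_iff_integrable_sq_norm hm.aestronglyMeasurable]
    refine hE.mono' (hm.norm.pow_const 2).aestronglyMeasurable (Eventually.of_forall fun u => ?_)
    have : ‖φ u‖ ≤ 1 := (hb u).trans (by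
      rw [Real.exp_le_one_iff]; nlinarith [abs_nonneg u])
    rw [Real.norm_of_nonneg (by positivity)]
    nlinarith [hb u, norm_nonneg (φ u)]
  have hF := memLp_fourier_aux φ hφ1 hφ2
  have hF2 : Integrable (fun x => ‖(𝓕 φ : ℝ → ℂ) x‖ ^ 2) := 
    (memLp_two_iff_integrable_sq_norm hF.1).1 hF
  have := hF2.comp_mul_right' (R := -(1 / (2 * Real.pi))) (by simp [Real.pi_ne_zero])
  refine this.congr (Eventually.of_forall fun t => ?_)
  simp only
  rw [zeta_fract (by simpa using h0) (by simpa using h1), mellin_eq_fourier, norm_neg]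
  have e1 : ((-(σ + t * I : ℂ)).im / (2 * Real.pi)) = t * -(1 / (2 * Real.pi)) := by
    simp; ring
  have e2 : (-(-(σ + t * I : ℂ)).re) = σ := by simp
  rw [e1, e2]
lemma cont_bot {g : ℝ → ℂ} (hg : ContinuousOn g (Ici 0)) :
    g =O[nhdsWithin 0 (Ioi 0)] (fun x : ℝ => x ^ (-(0:ℝ))) := by
  have h : Tendsto g (nhdsWithin 0 (Ioi 0)) (nhds (g 0)) :=
    (hg 0 (by simp)).mono_left (nhdsWithin_mono _ Ioi_subset_Ici_self)
  simpa using h.isBigO_one ℝ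

lemma cont_loc {g : ℝ → ℂ} (hg : ContinuousOn g (Ici 0)) : LocallyIntegrableOn g (Ioi 0) :=
  (hg.mono Ioi_subset_Ici_self).locallyIntegrableOn measurableSet_Ioi

lemma cont_conv {g : ℝ → ℂ} {a : ℝ} (hg : ContinuousOn g (Ici 0))
    (ho : g =O[atTop] fun x : ℝ => x ^ (-a)) {s : ℂ} (h0 : 0 < s.re) (h1 : s.re < a) :
    MellinConvergent g s :=
  mellinConvergent_of_isBigO_rpow (cont_loc hg) ho h1 (cont_bot hg) h0

lemma mellin_ibp {g g' : ℝ → ℂ} {a : ℝ} (hg : ContinuousOn g (Ici 0))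
    (hg' : ContinuousOn g' (Ici 0)) (hd : ∀ x ∈ Ioi (0:ℝ), HasDerivAt g (g' x) x)
    (ho : g =O[atTop] fun x : ℝ => x ^ (-a)) (ho' : g' =O[atTop] fun x : ℝ => x ^ (-(a + 1)))
    {s : ℂ} (h0 : 0 < s.re) (h1 : s.re < a) :
    s * mellin g s = - mellin g' (s + 1) := by
  have hs : s ≠ 0 := by rintro rfl; simp at h0
  have c1 := cont_conv hg ho h0 h1
  have c2 := cont_conv (s := s + 1) hg' ho' (by simp; linarith) (by simp; linarith)
  have hv : ∀ x ∈ Ioi (0:ℝ), HasDerivAt (fun x : ℝ => (x:ℂ) ^ s) (s * (x:ℂ) ^ (s - 1)) x := by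
    intro x hx
    exact hasDerivAt_ofReal_cpow_const (ne_of_gt hx) hs
  have hxs : ∀ᶠ x : ℝ in atTop, ‖(x:ℂ) ^ s‖ = x ^ s.re := by
    filter_upwards [eventually_gt_atTop 0] with x hx
    exact Complex.norm_cpow_eq_rpow_re_of_pos hx s
  have key := integral_Ioi_mul_deriv_eq_deriv_mul (a := (0:ℝ)) (a' := (0:ℂ)) (b' := (0:ℂ)) hd hv
    ?_ ?_ ?_ ?_
  · rw [mellin, mellin]
    simp only [smul_eq_mul, add_sub_cancel_right]
    rw [← integral_const_mul]
    calc _ = ∫ x in Ioi (0:ℝ), g x * (s * (x:ℂ) ^ (s - 1)) := by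
          congr 1; ext x; ring
      _ = _ := by
          rw [key]; simp only [sub_zero, zero_sub]
          congr 2; ext x; ring
  · have := c1.const_mul s
    refine (this : Integrable _ _).congr (Eventually.of_forall fun x => ?_)
    simp; ring
  · refine (c2 : Integrable _ _).congr (Eventually.of_forall fun x => ?_)
    simp; ring
  · have t1 : Tendsto g (nhdsWithin 0 (Ioi 0)) (nhds (g 0)) :=
      (hg 0 (by simp)).mono_left (nhdsWithin_mono _ Ioi_subset_Ici_self)
    have t2 : Tendsto (fun x : ℝ => (x:ℂ) ^ s) (nhdsWithin 0 (Ioi 0)) (nhds 0) := by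
      have := (Complex.continuousAt_ofReal_cpow_const 0 s (Or.inl h0)).tendsto
      simp only [ofReal_zero, Complex.zero_cpow hs] at this
      exact this.mono_left nhdsWithin_le_nhds
    have t3 := t1.mul t2
    rw [mul_zero] at t3
    exact t3
  · have hO : (g * fun x : ℝ => (x:ℂ) ^ s) =O[atTop] fun x : ℝ => x ^ (-(a - s.re)) := by
      have h2 : (fun x : ℝ => (x:ℂ) ^ s) =O[atTop] fun x : ℝ => x ^ s.re := by
        apply IsBigO.of_bound 1
        filter_upwards [hxs, eventually_gt_atTop 0] with x hx hx0
        rw [hx, one_mul, Real.norm_of_nonneg (by positivity)]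
      refine (ho.mul h2).trans (IsBigO.of_bound 1 ?_)
      filter_upwards [eventually_gt_atTop 0] with x hx0
      rw [← Real.rpow_add hx0, one_mul]
      apply le_of_eq; congr 2; ring
    exact hO.trans_tendsto (tendsto_rpow_neg_atTop (by linarith))

lemma mellin_bdd {g : ℝ → ℂ} {a : ℝ} (hg : ContinuousOn g (Ici 0))
    (ho : g =O[atTop] fun x : ℝ => x ^ (-a)) {p q : ℝ} (hp : 0 < p) (hq : q < a) (hpq : p ≤ q) :
    ∃ C, 0 ≤ C ∧ ∀ s : ℂ, p ≤ s.re → s.re ≤ q → ‖mellin g s‖ ≤ C := by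
  have c1 := (cont_conv (s := (p:ℂ)) hg ho (by simpa) (by simp; linarith)).norm
  have c2 := (cont_conv (s := (q:ℂ)) hg ho (by simp; linarith) (by simp; linarith)).norm
  refine ⟨∫ x in Ioi (0:ℝ), (‖(x:ℂ) ^ ((p:ℂ) - 1) • g x‖ + ‖(x:ℂ) ^ ((q:ℂ) - 1) • g x‖),
    by positivity, fun s h1 h2 => ?_⟩
  refine norm_integral_le_of_norm_le (c1.add c2) ?_
  filter_upwards [ae_restrict_mem measurableSet_Ioi] with t ht
  have ht0 : (0:ℝ) < t := ht
  simp only [norm_smul, Complex.norm_cpow_eq_rpow_re_of_pos ht0, sub_re, ofReal_re, one_re]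
  rw [← add_mul]
  gcongr
  rcases le_total t 1 with h | h
  · have := Real.rpow_le_rpow_of_exponent_ge ht0 h (by linarith : p - 1 ≤ s.re - 1)
    have : 0 ≤ t ^ (q - 1) := by positivity
    linarith
  · have := Real.rpow_le_rpow_of_exponent_le h (by linarith : s.re - 1 ≤ q - 1)
    have : 0 ≤ t ^ (p - 1) := by positivity
    linarith

lemma mellin_rl (g : ℝ → ℂ) (σ : ℝ) :
    Tendsto (fun t : ℝ => mellin g (σ + t * I)) (cocompact ℝ) (nhds 0) := by
  have h := Real.zero_at_infty_fourier (fun (u : ℝ) ↦ (Real.exp (-σ * u) • g (Real.exp (-u))))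
  have h2 : Tendsto (fun t : ℝ => t / (2 * Real.pi)) (cocompact ℝ) (cocompact ℝ) := by
    have := (Homeomorph.mulRight₀ ((2 * Real.pi)⁻¹) (by simp [Real.pi_ne_zero])).isClosedEmbedding.tendsto_cocompact
    simpa [div_eq_mul_inv] using this
  refine (h.comp h2).congr fun t => ?_
  rw [mellin_eq_fourier]
  simp

/-- What we need from the Müntz class. -/
lemma muntz_pack {α : ℝ} {f : ℝ → ℂ} (hf : MuntzClass α f) :
    ContinuousOn f (Ici 0) ∧ f =O[atTop] (fun x : ℝ => x ^ (-α)) ∧ ∃ f2 : ℝ → ℂ,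
      ContinuousOn f2 (Ici 0) ∧ f2 =O[atTop] (fun x : ℝ => x ^ (-(α + 2))) ∧
      ∀ s : ℂ, 0 < s.re → s.re < α → s * (s + 1) * mellin f s = mellin f2 (s + 2) := by
  obtain ⟨hc, ho⟩ := hf
  have hU : UniqueDiffOn ℝ (Ici (0:ℝ)) := uniqueDiffOn_Ici 0
  have c0 : ContinuousOn f (Ici 0) := hc.continuousOn
  have c1 := hc.continuousOn_iteratedDerivWithin (m := 1) (by norm_num) hU
  have c2 := hc.continuousOn_iteratedDerivWithin (m := 2) (by norm_num) hU
  have o0 := ho 0 (by norm_num)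
  have o1 := ho 1 (by norm_num)
  have o2 := ho 2 (by norm_num)
  simp only [iteratedDerivWithin_zero, Nat.cast_zero, add_zero, Nat.cast_one, Nat.cast_ofNat]
    at o0 o1 o2
  have d0 : ∀ x ∈ Ioi (0:ℝ), HasDerivAt f (iteratedDerivWithin 1 f (Ici 0) x) x := by
    intro x hx
    have h := (hc.differentiableOn (by norm_num) x (mem_Ici.2 (le_of_lt hx))).hasDerivWithinAt
    rw [iteratedDerivWithin_one]
    exact h.hasDerivAt (Ici_mem_nhds hx)
  have d1 : ∀ x ∈ Ioi (0:ℝ), HasDerivAt (iteratedDerivWithin 1 f (Ici 0))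
      (iteratedDerivWithin 2 f (Ici 0) x) x := by
    intro x hx
    have h := (hc.differentiableOn_iteratedDerivWithin (m := 1) (by norm_num) hU
      x (mem_Ici.2 (le_of_lt hx))).hasDerivWithinAt
    rw [← iteratedDerivWithin_succ] at h
    exact h.hasDerivAt (Ici_mem_nhds hx)
  refine ⟨c0, o0, _, c2, o2, fun s h0 h1 => ?_⟩
  have i1 := mellin_ibp c0 c1 d0 o0 o1 h0 h1
  have i2 := mellin_ibp (a := α + 1) (s := s + 1) c1 c2 d1 o1 (by convert o2 using 3; ring) 
    (by simp; linarith) (by simp; linarith)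
  rw [show s + 1 + 1 = s + 2 by ring] at i2
  linear_combination (s + 1) * i1 - i2

lemma divisor_hasSum {s : ℂ} (hs : 1 < s.re) :
    HasSum (fun n : ℕ => ((n + 1 : ℕ).divisors.card : ℂ) * ((n + 1 : ℕ) : ℂ) ^ (-s))
      (riemannZeta s ^ 2) := by
  have h1 : LSeriesHasSum (fun n => ((ArithmeticFunction.zeta n : ℕ) : ℂ)) s (riemannZeta s) :=
    ArithmeticFunction.LSeriesHasSum_zeta hs
  have h2 := h1.convolution h1
  unfold LSeriesHasSum at h2
  rw [← sq] at h2
  have h3 := (hasSum_nat_add_iff' 1).2 h2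
  simp only [Finset.range_one, Finset.sum_singleton, LSeries.term_zero, sub_zero] at h3
  refine h3.congr_fun ?_ 
  intro n
  rw [LSeries.term_of_ne_zero (Nat.succ_ne_zero n), div_eq_mul_inv, ← Complex.cpow_neg]
  congr 1
  rw [LSeries.convolution_def]
  simp only
  rw [Finset.sum_congr rfl (g := fun _ => (1:ℂ))]
  · simp [← Nat.map_div_right_divisors]
  · intro p hp
    have := Nat.ne_zero_of_mem_divisorsAntidiagonal hp
    simp [ArithmeticFunction.zeta_apply, this.1, this.2]

lemma divisor_summable {c : ℝ} (hc : 1 < c) :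
    Summable (fun n : ℕ => ((n + 1 : ℕ).divisors.card : ℝ) * ((n + 1 : ℕ) : ℝ) ^ (-c)) := by
  have h := (divisor_hasSum (s := (c:ℂ)) (by simpa)).summable.norm
  refine h.congr fun n => ?_
  rw [norm_mul, Complex.norm_natCast, Complex.norm_natCast_cpow_of_pos (Nat.succ_pos n)]
  simp

lemma int_inv_sq {a : ℝ} (ha : a ≠ 0) : Integrable (fun t : ℝ => (a ^ 2 + t ^ 2)⁻¹) := by
  have h := (integrable_inv_one_add_sq.comp_div ha).const_mul ((a ^ 2)⁻¹)
  refine h.congr (Eventually.of_forall fun t => ?_)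
  simp only
  rw [← mul_inv]; congr 1; field_simp

lemma integral_inv_sq {a : ℝ} (ha : a ≠ 0) : ∫ t : ℝ, (a ^ 2 + t ^ 2)⁻¹ = Real.pi / |a| := by
  have h : ∀ t : ℝ, (a ^ 2 + t ^ 2)⁻¹ = (a ^ 2)⁻¹ * (1 + (t / a) ^ 2)⁻¹ := by
    intro t
    rw [← mul_inv]; congr 1; field_simp
  simp_rw [h]
  rw [integral_const_mul, Measure.integral_comp_div (fun t : ℝ => (1 + t ^ 2)⁻¹) a,
    integral_univ_inv_one_add_sq, smul_eq_mul, ← sq_abs a]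
  have : |a| ≠ 0 := abs_ne_zero.2 ha
  field_simp

lemma line_ne {a : ℝ} (ha : a ≠ 0) (t : ℝ) : (a : ℂ) + t * I ≠ 0 := by
  intro h
  have := congrArg Complex.re h
  simp at this
  exact ha this

lemma line_normSq (a t : ℝ) : ‖(a : ℂ) + t * I‖ ^ 2 = a ^ 2 + t ^ 2 := by
  rw [← Complex.normSq_eq_norm_sq, Complex.normSq_add_mul_I]

lemma line_cont {a : ℝ} (ha : a ≠ 0) : Continuous (fun t : ℝ => ((a : ℂ) + t * I)⁻¹) :=
  Continuous.inv₀ (by fun_prop) (line_ne ha)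

lemma int_line_two {a b : ℝ} (ha : a ≠ 0) (hb : b ≠ 0) :
    Integrable (fun t : ℝ => ((a : ℂ) + t * I)⁻¹ * ((b : ℂ) + t * I)⁻¹) := by
  refine ((int_inv_sq ha).add (int_inv_sq hb)).mono'
    ((line_cont ha).mul (line_cont hb)).aestronglyMeasurable (Eventually.of_forall fun t => ?_)
  simp only [norm_mul, norm_inv, Pi.add_apply]
  rw [← line_normSq a t, ← line_normSq b t, ← inv_pow, ← inv_pow]
  nlinarith [sq_nonneg (‖(a : ℂ) + t * I‖⁻¹ - ‖(b : ℂ) + t * I‖⁻¹),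
    sq_nonneg (‖(a : ℂ) + t * I‖⁻¹), sq_nonneg (‖(b : ℂ) + t * I‖⁻¹)]

lemma integral_line_sq {a : ℝ} (ha : a ≠ 0) :
    ∫ t : ℝ, (((a : ℂ) + t * I)⁻¹) ^ 2 = 0 := by
  have hi : Integrable (fun t : ℝ => (((a : ℂ) + t * I)⁻¹) ^ 2) := by
    simpa only [sq] using int_line_two ha ha
  have hn : Tendsto (fun t : ℝ => ‖(a : ℂ) + t * I‖) (cocompact ℝ) atTop := by
    have : Tendsto (fun t : ℝ => |t|) (cocompact ℝ) atTop := tendsto_norm_cocompact_atTop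
    refine tendsto_atTop_mono (fun t => ?_) this
    simpa using Complex.abs_im_le_norm ((a : ℂ) + t * I)
  have h0 : Tendsto (fun t : ℝ => I * ((a : ℂ) + t * I)⁻¹) (cocompact ℝ) (nhds 0) := by
    rw [tendsto_zero_iff_norm_tendsto_zero]
    refine hn.inv_tendsto_atTop.congr fun t => ?_
    simp
  have := integral_of_hasDerivAt_of_tendsto (f := fun t : ℝ => I * ((a : ℂ) + t * I)⁻¹)
    (f' := fun t : ℝ => (((a : ℂ) + t * I)⁻¹) ^ 2) (m := 0) (n := 0) ?_ hi
    (h0.mono_left atBot_le_cocompact) (h0.mono_left atTop_le_cocompact)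
  · simpa using this
  · intro t
    have h1 : HasDerivAt (fun t : ℝ => (a : ℂ) + t * I) I t := by
      simpa using ((Complex.ofRealCLM.hasDerivAt (x := t)).mul_const I).const_add (a : ℂ)
    have := (h1.fun_inv (line_ne ha t)).const_mul I
    convert! this using 1
    have := line_ne ha t
    field_simp
    simp

lemma integral_line_diff {a b : ℝ} (ha : a ≠ 0) (hb : b ≠ 0) :
    ∫ t : ℝ, (((a : ℂ) + t * I)⁻¹ - ((b : ℂ) + t * I)⁻¹) =
      ((Real.pi * (a / |a|) - Real.pi * (b / |b|) : ℝ) : ℂ) := by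
  have hi : Integrable (fun t : ℝ => ((a : ℂ) + t * I)⁻¹ - ((b : ℂ) + t * I)⁻¹) := by
    refine ((int_line_two ha hb).const_mul ((b : ℂ) - a)).congr (Eventually.of_forall fun t => ?_)
    have := line_ne ha t
    have := line_ne hb t
    simp only
    field_simp
    ring
  have h1 := integral_neg_eq_self (fun t : ℝ => ((a : ℂ) + t * I)⁻¹ - ((b : ℂ) + t * I)⁻¹) volume
  have h2 := integral_add hi hi.comp_neg
  rw [h1] at h2
  have h3 : ∀ t : ℝ, (((a : ℂ) + t * I)⁻¹ - ((b : ℂ) + t * I)⁻¹) +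
      (((a : ℂ) + (-t : ℝ) * I)⁻¹ - ((b : ℂ) + (-t : ℝ) * I)⁻¹) =
      ((2 * a * (a ^ 2 + t ^ 2)⁻¹ - 2 * b * (b ^ 2 + t ^ 2)⁻¹ : ℝ) : ℂ) := by
    intro t
    have key : ∀ c : ℝ, c ≠ 0 → ((c : ℂ) + t * I)⁻¹ + ((c : ℂ) + (-t : ℝ) * I)⁻¹ =
        ((2 * c * (c ^ 2 + t ^ 2)⁻¹ : ℝ) : ℂ) := by
      intro c hc
      have e1 := line_ne hc t
      have e2 := line_ne hc (-t)
      have e3 : ((c : ℂ) ^ 2 + t ^ 2) = ((c : ℂ) + t * I) * ((c : ℂ) + (-t : ℝ) * I) := by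
        push_cast
        linear_combination ((t : ℂ) ^ 2) * Complex.I_sq
      push_cast at e2 e3 ⊢
      rw [e3, mul_inv]
      calc _ = ((c : ℂ) + t * I)⁻¹ * ((c : ℂ) + -t * I)⁻¹ *
            (((c : ℂ) + -t * I) + ((c : ℂ) + t * I)) := by
              rw [mul_add, mul_assoc, inv_mul_cancel₀ e2, mul_right_comm, inv_mul_cancel₀ e1]; ring
        _ = _ := by ring
    have k1 := key a ha
    have k2 := key b hb
    rw [Complex.ofReal_sub, ← k1, ← k2]
    ring
  simp only [h3] at h2
  rw [integral_complex_ofReal, integral_sub ((int_inv_sq ha).const_mul _) ((int_inv_sq hb).const_mul _),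
    integral_const_mul, integral_const_mul, integral_inv_sq ha, integral_inv_sq hb] at h2
  rw [show (((2 * a * (Real.pi / |a|) - 2 * b * (Real.pi / |b|) : ℝ)) : ℂ) =
    2 * ((Real.pi * (a / |a|) - Real.pi * (b / |b|) : ℝ) : ℂ) by push_cast; ring] at h2
  linear_combination -h2 / 2

lemma contour_shift {H : ℂ → ℂ} {a b C : ℝ} (hab : a ≤ b)
    (hd : DifferentiableOn ℂ H {s : ℂ | a ≤ s.re ∧ s.re ≤ b})
    (ia : Integrable (fun t : ℝ => H (a + t * I))) (ib : Integrable (fun t : ℝ => H (b + t * I)))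
    (hC : ∀ s : ℂ, a ≤ s.re → s.re ≤ b → 1 ≤ |s.im| → ‖H s‖ ≤ C)
    (hz : ∀ r : ℝ, a ≤ r → r ≤ b → Tendsto (fun t : ℝ => H (r + t * I)) (cocompact ℝ) (nhds 0)) :
    ∫ t : ℝ, H (a + t * I) = ∫ t : ℝ, H (b + t * I) := by
  have horiz : Tendsto (fun T : ℝ => ∫ x in a..b, H (x + T * I)) (cocompact ℝ) (nhds 0) := by
    have : (cocompact ℝ).IsCountablyGenerated := by
      rw [cocompact_eq_atBot_atTop]; infer_instance
    have := intervalIntegral.tendsto_integral_filter_of_dominated_convergence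
      (μ := volume) (a := a) (b := b)
      (F := fun (T : ℝ) (x : ℝ) => H (x + T * I)) (f := fun _ => (0:ℂ)) (l := cocompact ℝ)
      (fun _ => C) ?_ ?_ ?_ ?_
    · simpa using this
    · refine Eventually.of_forall fun T => ?_
      refine ContinuousOn.aestronglyMeasurable ?_ measurableSet_uIoc
      refine hd.continuousOn.comp (by fun_prop) ?_
      intro x hx
      rw [uIoc_of_le hab] at hx
      simpa using ⟨hx.1.le, hx.2⟩
    · have : ∀ᶠ T : ℝ in cocompact ℝ, 1 ≤ |T| :=
        (tendsto_norm_cocompact_atTop (E := ℝ)).eventually_ge_atTop 1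
      filter_upwards [this] with T hT
      refine Eventually.of_forall fun x hx => ?_
      rw [uIoc_of_le hab] at hx
      exact hC _ (by simpa using hx.1.le) (by simpa using hx.2) (by simpa using hT)
    · simp
    · refine Eventually.of_forall fun x hx => ?_
      rw [uIoc_of_le hab] at hx
      exact hz x hx.1.le hx.2
  have va := intervalIntegral_tendsto_integral ia tendsto_neg_atTop_atBot tendsto_id
  have vb := intervalIntegral_tendsto_integral ib tendsto_neg_atTop_atBot tendsto_id
  have h1 : Tendsto (fun T : ℝ => ∫ x in a..b, H (x + T * I)) atTop (nhds 0) :=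
    horiz.mono_left atTop_le_cocompact
  have h2 : Tendsto (fun T : ℝ => ∫ x in a..b, H (x + (-T : ℝ) * I)) atTop (nhds 0) :=
    (horiz.mono_left atBot_le_cocompact).comp tendsto_neg_atTop_atBot
  have rect : ∀ T : ℝ, (∫ x in a..b, H (x + (-T : ℝ) * I)) - (∫ x in a..b, H (x + T * I)) +
      I * (∫ y in (-T)..T, H (b + y * I)) - I * ∫ y in (-T)..T, H (a + y * I) = 0 := by
    intro T
    have := Complex.integral_boundary_rect_eq_zero_of_differentiableOn H
      ((a : ℂ) + (-T : ℝ) * I) ((b : ℂ) + T * I) (hd.mono ?_)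
    · simpa using this
    · intro s hs
      rw [mem_reProdIm] at hs
      have := hs.1
      simp [uIcc_of_le hab] at this
      exact this
  have lim := ((h2.sub h1).add (vb.const_mul I)).sub (va.const_mul I)
  have lim0 := tendsto_nhds_unique (lim.congr fun T => rect T) tendsto_const_nhds
  have : I * (∫ t : ℝ, H (b + t * I)) = I * ∫ t : ℝ, H (a + t * I) := by
    linear_combination lim0
  exact (mul_left_cancel₀ I_ne_zero this).symm

/-- Removing a double pole at `1`. -/
lemma pole_removal {K : ℂ → ℂ} {U : Set ℂ} (hU : IsOpen U) (h1 : (1:ℂ) ∈ U)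
    (hK : DifferentiableOn ℂ K U) : ∃ q : ℂ → ℂ, DifferentiableOn ℂ q U ∧
      ∀ s, s ≠ 1 → K s * ((s - 1)⁻¹) ^ 2 =
        K 1 * ((s - 1)⁻¹) ^ 2 + deriv K 1 * (s - 1)⁻¹ + q s := by
  have hn := hU.mem_nhds h1
  refine ⟨dslope (dslope K 1) 1, ?_, fun s hs => ?_⟩
  · rw [Complex.differentiableOn_dslope hn, Complex.differentiableOn_dslope hn]
    exact hK
  · have : s - 1 ≠ 0 := sub_ne_zero.2 hs
    rw [dslope_of_ne _ hs, slope_def_field, dslope_of_ne _ hs, slope_def_field, dslope_same]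
    field_simp
    ring

lemma mellin_diffAt {g : ℝ → ℂ} {a : ℝ} (hg : ContinuousOn g (Ici 0))
    (ho : g =O[atTop] fun x : ℝ => x ^ (-a)) {s : ℂ} (h0 : 0 < s.re) (h1 : s.re < a) :
    DifferentiableAt ℂ (mellin g) s :=
  mellin_differentiableAt_of_isBigO_rpow (cont_loc hg) ho h1 (cont_bot hg) h0

lemma mellin_line_cont {g : ℝ → ℂ} {a : ℝ} (hg : ContinuousOn g (Ici 0))
    (ho : g =O[atTop] fun x : ℝ => x ^ (-a)) {c : ℝ} (h0 : 0 < c) (h1 : c < a) :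
    Continuous (fun t : ℝ => mellin g (c + t * I)) := by
  rw [continuous_iff_continuousAt]
  intro t
  have h : ContinuousAt (mellin g) (c + t * I) :=
    (mellin_diffAt hg ho (by simpa) (by simpa)).continuousAt
  exact ContinuousAt.comp (f := fun t : ℝ => (c : ℂ) + t * I) h (by fun_prop)

lemma mellin_eq_f2 {α : ℝ} {f f2 : ℝ → ℂ}
    (hrel : ∀ s : ℂ, 0 < s.re → s.re < α → s * (s + 1) * mellin f s = mellin f2 (s + 2))
    {s : ℂ} (h0 : 0 < s.re) (h1 : s.re < α) :
    mellin f s = mellin f2 (s + 2) * (s⁻¹ * (s + 1)⁻¹) := by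
  have hs : s ≠ 0 := by rintro rfl; simp at h0
  have hs1 : s + 1 ≠ 0 := by
    intro h
    have := congrArg Complex.re h
    simp at this
    linarith
  rw [← hrel s h0 h1]
  field_simp

lemma mellin_vert {α : ℝ} {f f2 : ℝ → ℂ} (hc : ContinuousOn f (Ici 0))
    (ho : f =O[atTop] fun x : ℝ => x ^ (-α)) (hc2 : ContinuousOn f2 (Ici 0))
    (ho2 : f2 =O[atTop] fun x : ℝ => x ^ (-(α + 2)))
    (hrel : ∀ s : ℂ, 0 < s.re → s.re < α → s * (s + 1) * mellin f s = mellin f2 (s + 2))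
    {c : ℝ} (h0 : 0 < c) (h1 : c < α) :
    Integrable (fun t : ℝ => mellin f (c + t * I)) := by
  obtain ⟨C, hC0, hC⟩ := mellin_bdd hc2 ho2 (p := c + 2) (q := c + 2) (by linarith) (by linarith) le_rfl
  have hi := (int_line_two (a := c) (b := c + 1) (by linarith) (by linarith)).norm.const_mul C
  refine hi.mono' (mellin_line_cont hc ho h0 h1).aestronglyMeasurable
    (Eventually.of_forall fun t => ?_)
  rw [mellin_eq_f2 hrel (by simpa) (by simpa), norm_mul]
  have e : (c : ℂ) + t * I + 1 = ((c + 1 : ℝ) : ℂ) + t * I := by push_cast; ring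
  rw [e]
  gcongr
  exact hC _ (by simp) (by simp)

lemma line_c_hasSum {α : ℝ} {f : ℝ → ℂ} (hc : ContinuousOn f (Ici 0))
    (ho : f =O[atTop] fun x : ℝ => x ^ (-α)) {c : ℝ} (h0 : 1 < c) (h1 : c < α)
    (hv : Integrable (fun t : ℝ => mellin f (c + t * I))) {x : ℝ} (hx : 0 < x) :
    Integrable (fun t : ℝ => riemannZeta (c + t * I) ^ 2 *
      (mellin f (c + t * I) * (x : ℂ) ^ (-(c + t * I : ℂ)))) ∧
    HasSum (fun n : ℕ => ((n + 1 : ℕ).divisors.card : ℂ) * f ((n + 1 : ℝ) * x))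
      ((2 * Real.pi)⁻¹ • ∫ t : ℝ, riemannZeta (c + t * I) ^ 2 *
        (mellin f (c + t * I) * (x : ℂ) ^ (-(c + t * I : ℂ)))) := by
  have hxc : Continuous (fun t : ℝ => (x : ℂ) ^ (-(c + t * I : ℂ))) := by
    refine Continuous.const_cpow (by fun_prop) (Or.inl (by exact_mod_cast hx.ne'))
  have hxn : ∀ (y : ℝ), 0 < y → ∀ t : ℝ, ‖(y : ℂ) ^ (-(c + t * I : ℂ))‖ = y ^ (-c) := by
    intro y hy t
    rw [Complex.norm_cpow_eq_rpow_re_of_pos hy]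
    simp
  have hL : Integrable (fun t : ℝ => mellin f (c + t * I) * (x : ℂ) ^ (-(c + t * I : ℂ))) := by
    refine hv.mul_bdd (c := x ^ (-c)) hxc.aestronglyMeasurable
      (Eventually.of_forall fun t => (hxn x hx t).le)
  have hnc : ∀ n : ℕ, ‖(((n + 1 : ℕ) : ℝ) : ℂ)‖ = ((n + 1 : ℕ) : ℝ) := by
    intro n; rw [Complex.norm_real, Real.norm_natCast]
  let F : ℕ → ℝ → ℂ := fun n t => ((n + 1 : ℕ).divisors.card : ℂ) *
    ((n + 1 : ℕ) : ℂ) ^ (-(c + t * I : ℂ)) *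
      (mellin f (c + t * I) * (x : ℂ) ^ (-(c + t * I : ℂ)))
  have hterm : ∀ (n : ℕ) (t : ℝ), ‖((n + 1 : ℕ).divisors.card : ℂ) *
      ((n + 1 : ℕ) : ℂ) ^ (-(c + t * I : ℂ))‖ =
      ((n + 1 : ℕ).divisors.card : ℝ) * ((n + 1 : ℕ) : ℝ) ^ (-c) := by
    intro n t
    rw [norm_mul, Complex.norm_natCast, Complex.norm_natCast_cpow_of_pos (Nat.succ_pos n)]
    simp
  have hFi : ∀ n, Integrable (F n) := by
    intro n
    refine hL.bdd_mul (c := ((n + 1 : ℕ).divisors.card : ℝ) * ((n + 1 : ℕ) : ℝ) ^ (-c)) ?_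
      (Eventually.of_forall fun t => (hterm n t).le)
    refine Continuous.aestronglyMeasurable (continuous_const.mul ?_)
    exact Continuous.const_cpow (by fun_prop) (Or.inl (by exact_mod_cast Nat.succ_ne_zero n))
  have hsum := divisor_summable h0
  have hFs : Summable fun n => ∫ t, ‖F n t‖ := by
    refine (hsum.mul_right (∫ t : ℝ, ‖mellin f (c + t * I) * (x : ℂ) ^ (-(c + t * I : ℂ))‖)).congr
      fun n => ?_
    rw [← integral_const_mul]
    congr 1
    ext t
    rw [← hterm n t, ← norm_mul]
  have htsum : ∀ t : ℝ, ∑' n, F n t = riemannZeta (c + t * I) ^ 2 *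
      (mellin f (c + t * I) * (x : ℂ) ^ (-(c + t * I : ℂ))) := by
    intro t
    exact ((divisor_hasSum (s := c + t * I) (by simpa)).mul_right _).tsum_eq
  have hzb : ∀ t : ℝ, ‖riemannZeta (c + t * I) ^ 2‖ ≤ ∑' n : ℕ,
      ((n + 1 : ℕ).divisors.card : ℝ) * ((n + 1 : ℕ) : ℝ) ^ (-c) := by
    intro t
    exact (divisor_hasSum (s := c + t * I) (by simpa)).norm_le_of_bounded hsum.hasSum
      fun n => (hterm n t).le
  have hzc : Continuous (fun t : ℝ => riemannZeta (c + t * I) ^ 2) := by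
    rw [continuous_iff_continuousAt]
    intro t
    have h : ContinuousAt riemannZeta (c + t * I) := by
      refine (differentiableAt_riemannZeta ?_).continuousAt
      intro h
      have := congrArg Complex.re h
      simp at this
      linarith
    exact (ContinuousAt.comp (f := fun t : ℝ => (c : ℂ) + t * I) h (by fun_prop)).pow 2
  refine ⟨hL.bdd_mul hzc.aestronglyMeasurable (Eventually.of_forall hzb), ?_⟩
  have key := (hasSum_integral_of_summable_integral_norm hFi hFs).const_smul ((2 * Real.pi)⁻¹)
  simp_rw [htsum] at key
  refine key.congr_fun ?_
  intro n
  have hp : (0:ℝ) < (n + 1 : ℝ) * x := by positivity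
  have inv := mellinInv_mellin_eq c f hp
    (cont_conv hc ho (by simp; linarith) (by simpa)) hv
    ((hc _ hp.le).continuousAt (Ici_mem_nhds hp))
  rw [← inv, mellinInv, one_div, mul_smul_comm]
  congr 1
  rw [← integral_const_mul]
  congr 1
  ext t
  simp only [F]
  push_cast
  have := Complex.mul_cpow_ofReal_nonneg (a := (n + 1 : ℝ)) (b := x) (by positivity) hx.le
    (-(c + t * I : ℂ))
  push_cast at this
  rw [this, smul_eq_mul]
  ring

lemma voronoi_int {α : ℝ} (hα : 1 < α) {f : ℝ → ℂ} (hc : ContinuousOn f (Ici 0))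
    (ho : f =O[atTop] fun x : ℝ => x ^ (-α)) {x : ℝ} (hx : 0 < x) :
    IntegrableOn (fun y : ℝ => f (x * y) *
        ((Real.log y + 2 * Real.eulerMascheroniConstant : ℝ) : ℂ)) (Ioi 0) ∧
    ∃ D : ℂ, HasDerivAt (mellin f) D 1 ∧
      ∫ y in Ioi (0:ℝ), f (x * y) * ((Real.log y + 2 * Real.eulerMascheroniConstant : ℝ) : ℂ) =
        (x : ℂ)⁻¹ * (D + (2 * Real.eulerMascheroniConstant - Real.log x) * mellin f 1) := by
  have h1 : MellinConvergent f 1 := cont_conv hc ho (by simp) (by simpa)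
  obtain ⟨h2, hD⟩ := mellin_hasDerivAt_of_isBigO_rpow (s := 1) (cont_loc hc) ho (by simpa)
    (cont_bot hc) (by simp)
  have i1 : IntegrableOn f (Ioi 0) := by simpa [MellinConvergent] using h1
  have i2 : IntegrableOn (fun t : ℝ => (Real.log t : ℂ) * f t) (Ioi 0) := by
    simpa [MellinConvergent] using h2
  set k : ℂ := 2 * Real.eulerMascheroniConstant - Real.log x with hk
  have i3 : IntegrableOn (fun u : ℝ => (Real.log u : ℂ) * f u + k * f u) (Ioi 0) :=
    i2.add (i1.const_mul k)
  have e : ∀ y ∈ Ioi (0:ℝ), f (x * y) *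
      ((Real.log y + 2 * Real.eulerMascheroniConstant : ℝ) : ℂ) =
      (fun u : ℝ => (Real.log u : ℂ) * f u + k * f u) (x * y) := by
    intro y hy
    simp only [hk]
    rw [Real.log_mul hx.ne' (ne_of_gt hy)]
    push_cast
    ring
  refine ⟨?_, _, hD, ?_⟩
  · rw [integrableOn_congr_fun e measurableSet_Ioi, integrableOn_Ioi_comp_mul_left_iff
      (fun u : ℝ => (Real.log u : ℂ) * f u + k * f u) 0 hx, mul_zero]
    exact i3
  · rw [setIntegral_congr_fun measurableSet_Ioi e, integral_comp_mul_left_Ioi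
      (fun u : ℝ => (Real.log u : ℂ) * f u + k * f u) 0 hx, mul_zero,
      integral_add i2 (i1.const_mul k), integral_const_mul]
    simp [mellin]
    ring

lemma G_le {α : ℝ} {f f2 : ℝ → ℂ}
    (hrel : ∀ s : ℂ, 0 < s.re → s.re < α → s * (s + 1) * mellin f s = mellin f2 (s + 2))
    {x : ℝ} (hx : 0 < x) {s : ℂ} (h0 : 0 < s.re) (h1 : s.re < α) :
    ‖riemannZeta s ^ 2 * (mellin f s * (x : ℂ) ^ (-s))‖ ≤
      ‖riemannZeta s / s‖ ^ 2 * ‖mellin f2 (s + 2)‖ * x ^ (-s.re) := by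
  have hs : s ≠ 0 := by rintro rfl; simp at h0
  have hs1 : s + 1 ≠ 0 := by
    intro h
    have := congrArg Complex.re h
    simp at this
    linarith
  have hle : ‖s / (s + 1)‖ ≤ 1 := by
    rw [norm_div, div_le_one (norm_pos_iff.2 hs1), ← sq_le_sq₀ (norm_nonneg _) (norm_nonneg _),
      ← Complex.normSq_eq_norm_sq, ← Complex.normSq_eq_norm_sq, Complex.normSq_apply,
      Complex.normSq_apply]
    simp
    nlinarith
  have e : riemannZeta s ^ 2 * (mellin f s * (x : ℂ) ^ (-s)) =
      (riemannZeta s / s) ^ 2 * mellin f2 (s + 2) * (x : ℂ) ^ (-s) * (s / (s + 1)) := by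
    rw [← hrel s h0 h1]
    field_simp
  rw [e, norm_mul, norm_mul, norm_mul, norm_pow, Complex.norm_cpow_eq_rpow_re_of_pos hx, neg_re]
  exact mul_le_of_le_one_right (by positivity) hle

lemma line_sigma_int {α : ℝ} {f f2 : ℝ → ℂ} (hc : ContinuousOn f (Ici 0))
    (ho : f =O[atTop] fun x : ℝ => x ^ (-α)) (hc2 : ContinuousOn f2 (Ici 0))
    (ho2 : f2 =O[atTop] fun x : ℝ => x ^ (-(α + 2)))
    (hrel : ∀ s : ℂ, 0 < s.re → s.re < α → s * (s + 1) * mellin f s = mellin f2 (s + 2))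
    {x : ℝ} (hx : 0 < x) {σ : ℝ} (h0 : 0 < σ) (h1 : σ < 1) (hα : 1 < α) :
    Integrable (fun t : ℝ => riemannZeta (σ + t * I) ^ 2 *
      (mellin f (σ + t * I) * (x : ℂ) ^ (-(σ + t * I : ℂ)))) := by
  obtain ⟨C, hC0, hC⟩ := mellin_bdd hc2 ho2 (p := σ + 2) (q := σ + 2) (by linarith)
    (by linarith) le_rfl
  have hi := (zeta_sq_int h0 h1).mul_const (C * x ^ (-σ))
  refine hi.mono' (Continuous.aestronglyMeasurable ?_) (Eventually.of_forall fun t => ?_)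
  · refine Continuous.mul ?_ ((mellin_line_cont hc ho h0 (by linarith)).mul ?_)
    · rw [continuous_iff_continuousAt]
      intro t
      have h : ContinuousAt riemannZeta (σ + t * I) := by
        refine (differentiableAt_riemannZeta ?_).continuousAt
        intro h
        have := congrArg Complex.re h
        simp at this
        linarith
      exact (ContinuousAt.comp (f := fun t : ℝ => (σ : ℂ) + t * I) h (by fun_prop)).pow 2
    · exact Continuous.const_cpow (by fun_prop) (Or.inl (by exact_mod_cast hx.ne'))
  · refine (G_le hrel hx (by simpa) (by simp; linarith)).trans ?_
    simp only [add_re, ofReal_re, mul_re, I_re, mul_zero, ofReal_im, I_im, mul_one, sub_self,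
      add_zero]
    rw [mul_assoc]
    gcongr
    exact hC _ (by simp) (by simp)

lemma line_inv_tendsto (a : ℝ) :
    Tendsto (fun t : ℝ => ((a : ℂ) + t * I)⁻¹) (cocompact ℝ) (nhds 0) := by
  have hn : Tendsto (fun t : ℝ => ‖(a : ℂ) + t * I‖) (cocompact ℝ) atTop := by
    have : Tendsto (fun t : ℝ => |t|) (cocompact ℝ) atTop := tendsto_norm_cocompact_atTop
    refine tendsto_atTop_mono (fun t => ?_) this
    simpa using Complex.abs_im_le_norm ((a : ℂ) + t * I)
  rw [tendsto_zero_iff_norm_tendsto_zero]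
  refine hn.inv_tendsto_atTop.congr fun t => ?_
  simp

lemma main_shift {α : ℝ} {f f2 : ℝ → ℂ} (hc : ContinuousOn f (Ici 0))
    (ho : f =O[atTop] fun x : ℝ => x ^ (-α)) (hc2 : ContinuousOn f2 (Ici 0))
    (ho2 : f2 =O[atTop] fun x : ℝ => x ^ (-(α + 2)))
    (hrel : ∀ s : ℂ, 0 < s.re → s.re < α → s * (s + 1) * mellin f s = mellin f2 (s + 2))
    {x : ℝ} (hx : 0 < x) {σ c : ℝ} (h0 : 0 < σ) (h1 : σ < 1) (h2 : 1 < c) (h3 : c < α)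
    {D : ℂ} (hD : HasDerivAt (mellin f) D 1)
    (iσ : Integrable (fun t : ℝ => riemannZeta (σ + t * I) ^ 2 *
      (mellin f (σ + t * I) * (x : ℂ) ^ (-(σ + t * I : ℂ)))))
    (ic : Integrable (fun t : ℝ => riemannZeta (c + t * I) ^ 2 *
      (mellin f (c + t * I) * (x : ℂ) ^ (-(c + t * I : ℂ))))) :
    ∫ t : ℝ, riemannZeta (σ + t * I) ^ 2 *
      (mellin f (σ + t * I) * (x : ℂ) ^ (-(σ + t * I : ℂ))) =
    (∫ t : ℝ, riemannZeta (c + t * I) ^ 2 *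
      (mellin f (c + t * I) * (x : ℂ) ^ (-(c + t * I : ℂ)))) - 2 * Real.pi *
      ((x : ℂ)⁻¹ * (D + (2 * Real.eulerMascheroniConstant - Real.log x) * mellin f 1)) := by
  have hx0 : (x : ℂ) ≠ 0 := by exact_mod_cast hx.ne'
  let G : ℂ → ℂ := fun s => riemannZeta s ^ 2 * (mellin f s * (x : ℂ) ^ (-s))
  let K : ℂ → ℂ := fun s => riemannZeta₁ s ^ 2 * (mellin f s * (x : ℂ) ^ (-s))
  set B : ℂ := (x : ℂ)⁻¹ * (D + (2 * Real.eulerMascheroniConstant - Real.log x) * mellin f 1)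
    with hB
  let U : Set ℂ := {s : ℂ | 0 < s.re ∧ s.re < α}
  have hU : IsOpen U :=
    (isOpen_lt continuous_const Complex.continuous_re).inter
      (isOpen_lt Complex.continuous_re continuous_const)
  have h1U : (1:ℂ) ∈ U := by
    refine ⟨by simp, ?_⟩
    simp only [one_re]
    linarith
  have hpow : ∀ s : ℂ, HasDerivAt (fun s : ℂ => (x : ℂ) ^ (-s))
      (-((x : ℂ) ^ (-s) * Complex.log x)) s := by
    intro s
    have := (hasDerivAt_neg s).const_cpow (c := (x : ℂ)) (Or.inl hx0)
    simpa using this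
  have hK : DifferentiableOn ℂ K U := by
    intro s hs
    refine DifferentiableAt.differentiableWithinAt ?_
    exact ((differentiable_riemannZeta₁ s).pow 2).mul
      ((mellin_diffAt hc ho hs.1 hs.2).mul (hpow s).differentiableAt)
  have hK1 : deriv K 1 = B := by
    have a1 : HasDerivAt riemannZeta₁ (Real.eulerMascheroniConstant : ℂ) 1 := by
      have := (differentiable_riemannZeta₁ 1).hasDerivAt
      rwa [deriv_riemannZeta₁_one] at this
    have a2 := (a1.fun_pow 2).mul (hD.mul (hpow 1))
    have a3 := a2.deriv
    have a4 : deriv K 1 = _ := a3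
    rw [a4, hB]
    simp only [riemannZeta₁_one, Pi.mul_apply, cpow_neg_one, ofReal_log hx.le]
    norm_num
    ring
  obtain ⟨q, hq, hqe⟩ := pole_removal hU h1U hK
  rw [hK1] at hqe
  set A : ℂ := K 1
  let H : ℂ → ℂ := fun s => q s + B * (s + 1)⁻¹
  have hHG : ∀ s : ℂ, s ≠ 1 →
      H s = G s - A * ((s - 1)⁻¹) ^ 2 - B * ((s - 1)⁻¹ - (s + 1)⁻¹) := by
    intro s hs
    have e1 := hqe s hs
    have e2 : G s = K s * ((s - 1)⁻¹) ^ 2 := by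
      simp only [G, K]
      rw [riemannZeta_eq_inv_sub_mul hs]
      ring
    rw [e2, e1]
    simp only [H]
    ring
  have lineH : ∀ a : ℝ, a ≠ 1 → ∀ t : ℝ, H (a + t * I) = G (a + t * I) -
      A * (((a - 1 : ℝ) : ℂ) + t * I)⁻¹ ^ 2 -
      B * ((((a - 1 : ℝ) : ℂ) + t * I)⁻¹ - (((a + 1 : ℝ) : ℂ) + t * I)⁻¹) := by
    intro a ha t
    rw [hHG]
    · rw [show (a : ℂ) + t * I - 1 = ((a - 1 : ℝ) : ℂ) + t * I by push_cast; ring,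
        show (a : ℂ) + t * I + 1 = ((a + 1 : ℝ) : ℂ) + t * I by push_cast; ring]
    · intro h
      have := congrArg Complex.re h
      simp at this
      exact ha this
  have lineI : ∀ a : ℝ, 0 < a → a ≠ 1 → Integrable (fun t : ℝ => G (a + t * I)) →
      Integrable (fun t : ℝ => H (a + t * I)) ∧ ∫ t : ℝ, H (a + t * I) =
        (∫ t : ℝ, G (a + t * I)) -
          B * ((Real.pi * ((a - 1) / |a - 1|) - Real.pi : ℝ) : ℂ) := by
    intro a ha ha1 hG
    have n1 : a - 1 ≠ 0 := sub_ne_zero.2 ha1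
    have n2 : a + 1 ≠ 0 := by linarith
    have j1 : Integrable (fun t : ℝ => A * (((a - 1 : ℝ) : ℂ) + t * I)⁻¹ ^ 2) := by
      have := (int_line_two n1 n1).const_mul A
      simpa only [sq] using this
    have j2 : Integrable (fun t : ℝ =>
        B * ((((a - 1 : ℝ) : ℂ) + t * I)⁻¹ - (((a + 1 : ℝ) : ℂ) + t * I)⁻¹)) := by
      refine (((int_line_two n1 n2).const_mul (((a + 1 : ℝ) : ℂ) - ((a - 1 : ℝ) : ℂ))).const_mul
        B).congr (Eventually.of_forall fun t => ?_)
      have := line_ne n1 t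
      have := line_ne n2 t
      simp only
      field_simp
      ring
    simp_rw [lineH a ha1]
    have j3 : Integrable (fun t : ℝ => G (a + t * I) -
        A * (((a - 1 : ℝ) : ℂ) + t * I)⁻¹ ^ 2) := hG.sub j1
    refine ⟨j3.sub j2, ?_⟩
    rw [integral_sub j3 j2, integral_sub hG j1, integral_const_mul, integral_const_mul,
      integral_line_sq n1, integral_line_diff n1 n2]
    have : (a + 1) / |a + 1| = 1 := by
      rw [abs_of_pos (by linarith)]
      field_simp
    rw [this]
    simp
  obtain ⟨hσ1, hσ2⟩ := lineI σ h0 h1.ne iσ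
  obtain ⟨hc1, hc3⟩ := lineI c (by linarith) h2.ne' ic
  obtain ⟨C, hC0, hC⟩ := mellin_bdd hc2 ho2 (p := σ + 2) (q := c + 2) (by linarith)
    (by linarith) (by linarith)
  have im1 : ∀ s : ℂ, 1 ≤ |s.im| → s ≠ 1 ∧ ‖(s - 1)⁻¹‖ ≤ 1 ∧ ‖(s + 1)⁻¹‖ ≤ 1 := by
    intro s hs
    refine ⟨?_, ?_, ?_⟩
    · rintro rfl
      simp at hs
      linarith
    · rw [norm_inv]
      apply inv_le_one_of_one_le₀
      have := Complex.abs_im_le_norm (s - 1)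
      simp at this
      linarith
    · rw [norm_inv]
      apply inv_le_one_of_one_le₀
      have := Complex.abs_im_le_norm (s + 1)
      simp at this
      linarith
  have Gb : ∀ s : ℂ, σ ≤ s.re → s.re ≤ c → 1 ≤ |s.im| →
      ‖G s‖ ≤ (1 + 1 / σ) ^ 2 * ‖mellin f2 (s + 2)‖ * (x ^ (-σ) + x ^ (-c)) := by
    intro s hs1 hs2 hs3
    obtain ⟨m1, m2, m3⟩ := im1 s hs3
    refine (G_le hrel hx (by linarith) (by linarith)).trans ?_
    have zb : ‖riemannZeta s / s‖ ≤ 1 + 1 / σ := by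
      refine (zeta_div_bound (by linarith) m1).trans ?_
      rw [norm_inv, ← one_div] at m2
      have : 1 / s.re ≤ 1 / σ := one_div_le_one_div_of_le h0 hs1
      linarith
    have xb : x ^ (-s.re) ≤ x ^ (-σ) + x ^ (-c) := by
      rcases le_total x 1 with h | h
      · have := Real.rpow_le_rpow_of_exponent_ge hx h (by linarith : -c ≤ -s.re)
        have : 0 ≤ x ^ (-σ) := by positivity
        linarith
      · have := Real.rpow_le_rpow_of_exponent_le h (by linarith : -s.re ≤ -σ)
        have : 0 ≤ x ^ (-c) := by positivity
        linarith
    gcongr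
  have shift := contour_shift (H := H) (a := σ) (b := c)
    (C := (1 + 1 / σ) ^ 2 * C * (x ^ (-σ) + x ^ (-c)) + ‖A‖ + ‖B‖ * 2) (by linarith) ?_ hσ1 hc1 ?_ ?_
  · rw [hσ2, hc3] at shift
    have s1 : (σ - 1) / |σ - 1| = -1 := by
      rw [abs_of_neg (by linarith), div_neg, div_self (by linarith)]
    have s2 : (c - 1) / |c - 1| = 1 := by
      rw [abs_of_pos (by linarith), div_self (by linarith)]
    rw [s1, s2] at shift
    push_cast at shift
    simp only [G] at shift
    linear_combination shift
  · intro s hs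
    have hsU : s ∈ U := ⟨by linarith [hs.1], by linarith [hs.2]⟩
    refine DifferentiableAt.differentiableWithinAt ?_
    refine ((hq s hsU).differentiableAt (hU.mem_nhds hsU)).add
      ((differentiableAt_const B).mul (DifferentiableAt.inv (by fun_prop) ?_))
    intro h
    have := congrArg Complex.re h
    simp at this
    linarith [hs.1]
  · intro s hs1 hs2 hs3
    obtain ⟨m1, m2, m3⟩ := im1 s hs3
    rw [hHG s m1]
    have g1 := Gb s hs1 hs2 hs3
    have g2 : ‖mellin f2 (s + 2)‖ ≤ C := hC _ (by simpa) (by simpa)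
    have g3 : (1 + 1 / σ) ^ 2 * ‖mellin f2 (s + 2)‖ * (x ^ (-σ) + x ^ (-c)) ≤
        (1 + 1 / σ) ^ 2 * C * (x ^ (-σ) + x ^ (-c)) := by gcongr
    have g4 : ‖A * ((s - 1)⁻¹) ^ 2‖ ≤ ‖A‖ := by
      rw [norm_mul, norm_pow]
      exact mul_le_of_le_one_right (norm_nonneg _) (pow_le_one₀ (norm_nonneg _) m2)
    have g5 : ‖B * ((s - 1)⁻¹ - (s + 1)⁻¹)‖ ≤ ‖B‖ * 2 := by
      rw [norm_mul]
      gcongr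
      exact (norm_sub_le _ _).trans (by linarith)
    have g6 := norm_sub_le (G s - A * ((s - 1)⁻¹) ^ 2) (B * ((s - 1)⁻¹ - (s + 1)⁻¹))
    have g7 := norm_sub_le (G s) (A * ((s - 1)⁻¹) ^ 2)
    linarith
  · intro r hr1 hr2
    have Gz : Tendsto (fun t : ℝ => G (r + t * I)) (cocompact ℝ) (nhds 0) := by
      have rl := (mellin_rl f2 (r + 2)).norm.const_mul ((1 + 1 / σ) ^ 2 * (x ^ (-σ) + x ^ (-c)))
      rw [norm_zero, mul_zero] at rl
      refine squeeze_zero_norm' ?_ rl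
      have : ∀ᶠ T : ℝ in cocompact ℝ, 1 ≤ |T| :=
        (tendsto_norm_cocompact_atTop (E := ℝ)).eventually_ge_atTop 1
      filter_upwards [this] with t ht
      have := Gb (r + t * I) (by simpa) (by simpa) (by simpa)
      rw [show (r : ℂ) + t * I + 2 = ((r + 2 : ℝ) : ℂ) + t * I by push_cast; ring] at this
      linarith
    have z1 := line_inv_tendsto (r - 1)
    have z2 := line_inv_tendsto (r + 1)
    have z := (Gz.sub ((z1.pow 2).const_mul A)).sub ((z1.sub z2).const_mul B)
    simp only [ne_eq, OfNat.ofNat_ne_zero, not_false_eq_true, zero_pow, mul_zero, sub_zero] at z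
    refine z.congr' ?_
    have : ∀ᶠ T : ℝ in cocompact ℝ, 1 ≤ |T| :=
      (tendsto_norm_cocompact_atTop (E := ℝ)).eventually_ge_atTop 1
    filter_upwards [this] with t ht
    rw [hHG _ (im1 (r + t * I) (by simpa)).1,
      show (r : ℂ) + t * I - 1 = ((r - 1 : ℝ) : ℂ) + t * I by push_cast; ring,
      show (r : ℂ) + t * I + 1 = ((r + 1 : ℝ) : ℂ) + t * I by push_cast; ring]

/-- the Voronoi operator is well defined and is represented by a line integral. -/
theorem voronoi_operator_representation (α : ℝ) (hα : 1 < α) (f : ℝ → ℂ)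
    (hf : MuntzClass α f) :
    ∀ x : ℝ, 0 < x →
      Summable (fun n : ℕ => ((n + 1 : ℕ).divisors.card : ℂ) * f ((n + 1 : ℝ) * x)) ∧
      IntegrableOn (fun y : ℝ => f (x * y) *
        ((Real.log y + 2 * Real.eulerMascheroniConstant : ℝ) : ℂ)) (Ioi 0) ∧
      ∀ σ : ℝ, 0 < σ → σ < 1 →
        lineIntegral (fun s => riemannZeta s ^ 2 * mellinT f s * (x : ℂ) ^ (-s)) σ =
          voronoiOp f x := by
  intro x hx
  obtain ⟨hc, ho, f2, hc2, ho2, hrel⟩ := muntz_pack hf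
  have k1 : 1 < (1 + α) / 2 := by linarith
  have k2 : (1 + α) / 2 < α := by linarith
  have hv := mellin_vert hc ho hc2 ho2 hrel (c := (1 + α) / 2) (by linarith) k2
  obtain ⟨ic, hs⟩ := line_c_hasSum hc ho k1 k2 hv hx
  obtain ⟨hi, D, hD, hint⟩ := voronoi_int hα hc ho hx
  refine ⟨hs.summable, hi, fun σ h0 h1 => ?_⟩
  have iσ := line_sigma_int hc ho hc2 ho2 hrel hx h0 h1 hα
  have key := main_shift hc ho hc2 ho2 hrel hx h0 h1 k1 k2 hD iσ ic
  rw [lineIntegral, voronoiOp, hint, hs.tsum_eq]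
  have e : ∀ s, mellinT f s = mellin f s := fun s => rfl
  simp only [e, mul_assoc]
  simp only [mul_assoc] at key
  rw [key, smul_sub]
  congr 1
  have : (Real.pi : ℂ) ≠ 0 := by exact_mod_cast Real.pi_ne_zero
  rw [Complex.real_smul]
  push_cast
  field_simp
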